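/- Let m ≥ 1 be an integer and α > 0. Let γ_m denote the standard Gaussian measure on ℝ^m (i.i.d. N(0,1) coordinates). Then ∫_{ℝ^m} 1{‖x‖_2 ≤ 1/α}·( 2α²‖x‖_2² − 2α‖x‖_2 ) dγ_m(x) = (1/Γ(m/2))·[ 4α²·γ((m+2)/2, 1/(2α²)) − 2√2·α·γ((m+1)/2, 1/(2α²)) ], where Γ is the gamma function and γ(a, x) = ∫_0^x t^(a−1) e^(−t) dt is the lower incomplete gamma function. -/

import Mathlib

open MeasureTheory ProbabilityTheory

/-- The lower incomplete gamma function `γ(a, x) = ∫_0^x t^(a-1) e^(-t) dt`. -/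
noncomputable def lowerIncompleteGamma (a x : ℝ) : ℝ :=
  ∫ t in (0 : ℝ)..x, t ^ (a - 1) * Real.exp (-t)

/-- A product of measures with real densities has the product of the densities as density. -/
lemma pi_withDensity_ofReal {ι : Type*} [Fintype ι] {X : ι → Type*} [∀ i, MeasurableSpace (X i)]
    (μ : ∀ i, Measure (X i)) [∀ i, SigmaFinite (μ i)] (f : ∀ i, X i → ℝ)
    (hf : ∀ i, Integrable (f i) (μ i)) (hf0 : ∀ i x, 0 ≤ f i x)
    [∀ i, SigmaFinite ((μ i).withDensity fun x => ENNReal.ofReal (f i x))] :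
    Measure.pi (fun i => (μ i).withDensity fun x => ENNReal.ofReal (f i x)) =
      (Measure.pi μ).withDensity fun x => ENNReal.ofReal (∏ i, f i (x i)) := by
  refine Measure.pi_eq fun s hs => ?_
  rw [withDensity_apply _ (MeasurableSet.univ_pi hs), Measure.restrict_pi_pi,
    ← ofReal_integral_eq_lintegral_ofReal
      (Integrable.fintype_prod_dep fun i => (hf i).restrict)
      (.of_forall fun x => Finset.prod_nonneg fun i _ => hf0 i _),
    integral_fintype_prod_eq_prod,
    ENNReal.ofReal_prod_of_nonneg fun i _ => integral_nonneg (hf0 i)]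
  refine Finset.prod_congr rfl fun i _ => ?_
  rw [withDensity_apply _ (hs i),
    ofReal_integral_eq_lintegral_ofReal (hf i).restrict (.of_forall (hf0 i))]

/-- The standard Gaussian measure on `ι → ℝ` in terms of its density. -/
lemma pi_gaussianReal_eq_withDensity (ι : Type*) [Fintype ι] :
    Measure.pi (fun _ : ι => gaussianReal 0 1) =
      (volume : Measure (ι → ℝ)).withDensity
        fun x => ENNReal.ofReal (∏ i, gaussianPDFReal 0 1 (x i)) := by
  have h : gaussianReal 0 1 =
      (volume : Measure ℝ).withDensity fun x => ENNReal.ofReal (gaussianPDFReal 0 1 x) :=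
    gaussianReal_of_var_ne_zero 0 one_ne_zero
  have : SigmaFinite
      ((volume : Measure ℝ).withDensity fun x => ENNReal.ofReal (gaussianPDFReal 0 1 x)) := by
    rw [← h]; infer_instance
  rw [h, volume_pi]
  exact pi_withDensity_ofReal (fun _ : ι => volume) (fun _ => gaussianPDFReal 0 1)
    (fun _ => integrable_gaussianPDFReal 0 1) (fun _ => gaussianPDFReal_nonneg 0 1)

lemma prod_gaussianPDFReal {ι : Type*} [Fintype ι] (x : ι → ℝ) :
    ∏ i, gaussianPDFReal 0 1 (x i) =
      (√(2 * Real.pi))⁻¹ ^ Fintype.card ι * Real.exp (-(∑ i, x i ^ 2) / 2) := by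
  simp [gaussianPDFReal, Finset.prod_mul_distrib, ← Real.exp_sum, Finset.sum_div, neg_div]

/-- Integration of a radial function against the standard Gaussian measure. -/
lemma integral_radial_pi_gaussianReal (ι : Type*) [Fintype ι] [Nonempty ι] (f : ℝ → ℝ) :
    ∫ x : ι → ℝ, f √(∑ i, x i ^ 2) ∂(Measure.pi fun _ : ι => gaussianReal 0 1) =
      2 / (Real.Gamma (Fintype.card ι / 2) * √2 ^ Fintype.card ι) *
        ∫ r in Set.Ioi (0 : ℝ), r ^ (Fintype.card ι - 1) * (Real.exp (-r ^ 2 / 2) * f r) := by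
  have hm : (0 : ℝ) < Fintype.card ι := by exact_mod_cast Fintype.card_pos
  have hΓ : 0 < Real.Gamma (Fintype.card ι / 2) := Real.Gamma_pos_of_pos (by positivity)
  have hd : Measurable fun x : ι → ℝ => ENNReal.ofReal (∏ i, gaussianPDFReal 0 1 (x i)) := by
    fun_prop
  rw [pi_gaussianReal_eq_withDensity, integral_withDensity_eq_integral_toReal_smul hd
    (.of_forall fun _ => ENNReal.ofReal_lt_top)]
  have h (x : ι → ℝ) : (ENNReal.ofReal (∏ i, gaussianPDFReal 0 1 (x i))).toReal •
      f √(∑ i, x i ^ 2) = (√(2 * Real.pi))⁻¹ ^ Fintype.card ι *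
        (Real.exp (-‖WithLp.toLp 2 x‖ ^ 2 / 2) * f ‖WithLp.toLp 2 x‖) := by
    have hs : 0 ≤ ∑ i, x i ^ 2 := Finset.sum_nonneg fun i _ => sq_nonneg _
    rw [ENNReal.toReal_ofReal (Finset.prod_nonneg fun i _ => gaussianPDFReal_nonneg 0 1 _),
      prod_gaussianPDFReal, smul_eq_mul, mul_assoc, EuclideanSpace.norm_eq]
    simp [Real.sq_sqrt hs]
  simp_rw [h]
  rw [integral_const_mul, (PiLp.volume_preserving_toLp ι).integral_comp
    (MeasurableEquiv.toLp 2 (ι → ℝ)).measurableEmbedding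
    (fun y : EuclideanSpace ℝ ι => Real.exp (-‖y‖ ^ 2 / 2) * f ‖y‖),
    integral_fun_norm_addHaar volume fun r => Real.exp (-r ^ 2 / 2) * f r, finrank_euclideanSpace,
    measureReal_def, EuclideanSpace.volume_ball, ENNReal.ofReal_one, one_pow, one_mul,
    ENNReal.toReal_ofReal (by positivity), Real.Gamma_add_one (by positivity),
    Real.sqrt_mul zero_le_two, nsmul_eq_mul]
  simp only [smul_eq_mul, ← mul_assoc]
  congr 1
  field_simp
  rw [← mul_pow, ← mul_pow, div_mul_eq_mul_div, div_mul_eq_mul_div, one_mul, mul_comm √Real.pi,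
    div_self (by positivity), one_pow]

lemma integral_pow_mul_exp_neg_sq_div_two (n : ℕ) {b : ℝ} (hb : 0 ≤ b) :
    ∫ r in (0 : ℝ)..b, r ^ (n + 1) * Real.exp (-r ^ 2 / 2) =
      √2 ^ n * lowerIncompleteGamma (((n : ℝ) + 2) / 2) (b ^ 2 / 2) := by
  have ha : 0 ≤ ((n : ℝ) + 2) / 2 - 1 := by linarith [n.cast_nonneg (α := ℝ)]
  have hg : Continuous fun t : ℝ => t ^ (((n : ℝ) + 2) / 2 - 1) * Real.exp (-t) :=
    (Real.continuous_rpow_const ha).mul (by fun_prop)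
  have hsubst := intervalIntegral.integral_comp_mul_deriv (a := 0) (b := b)
    (f := fun r : ℝ => r ^ 2 / 2) (f' := fun r => r)
    (fun r _ => by simpa using (hasDerivAt_pow 2 r).div_const 2) continuousOn_id hg
  rw [zero_pow two_ne_zero, zero_div] at hsubst
  rw [lowerIncompleteGamma, ← hsubst, ← intervalIntegral.integral_const_mul]
  refine intervalIntegral.integral_congr fun r hr => ?_
  have hr0 : 0 ≤ r := (Set.uIcc_of_le hb ▸ hr).1
  have hpow : (r ^ 2 / 2) ^ (((n : ℝ) + 2) / 2 - 1) = (r / √2) ^ n := by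
    have hsq : r ^ 2 / 2 = (r / √2) ^ (2 : ℝ) := by
      rw [Real.rpow_two, div_pow, Real.sq_sqrt zero_le_two]
    rw [hsq, ← Real.rpow_mul (by positivity), ← Real.rpow_natCast (r / √2) n]
    ring_nf
  simp only [Function.comp_apply, hpow, div_pow, neg_div]
  field_simp
  ring

/-- Let `γ_m` be the standard Gaussian measure on `ℝ^m` (i.i.d. `N(0,1)`
coordinates).  For `α > 0`,
`∫ 1{‖x‖₂ ≤ 1/α} (2α²‖x‖₂² - 2α‖x‖₂) dγ_m(x)
  = (1/Γ(m/2)) [4α² γ((m+2)/2, 1/(2α²)) - 2√2 α γ((m+1)/2, 1/(2α²))]`,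
where `Γ` is the gamma function and `γ(a,x)` the lower incomplete gamma function. -/
theorem stmt_11 (m : ℕ) (hm : 1 ≤ m) (α : ℝ) (hα : 0 < α) :
    ∫ x : Fin m → ℝ,
        (if Real.sqrt (∑ i, x i ^ 2) ≤ 1 / α then
          2 * α ^ 2 * (∑ i, x i ^ 2) - 2 * α * Real.sqrt (∑ i, x i ^ 2)
        else 0)
        ∂(Measure.pi fun _ : Fin m => gaussianReal 0 1)
      = 1 / Real.Gamma ((m : ℝ) / 2) *
        (4 * α ^ 2 * lowerIncompleteGamma (((m : ℝ) + 2) / 2) (1 / (2 * α ^ 2)) -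
          2 * Real.sqrt 2 * α * lowerIncompleteGamma (((m : ℝ) + 1) / 2) (1 / (2 * α ^ 2))) := by
  obtain ⟨n, rfl⟩ := Nat.exists_eq_add_of_le' hm
  have hΓ : 0 < Real.Gamma ((n + 1 : ℕ) / 2) := Real.Gamma_pos_of_pos (by positivity)
  have hradial := integral_radial_pi_gaussianReal (Fin (n + 1))
    fun r => if r ≤ 1 / α then 2 * α ^ 2 * r ^ 2 - 2 * α * r else 0
  have hsq (x : Fin (n + 1) → ℝ) : √(∑ i, x i ^ 2) ^ 2 = ∑ i, x i ^ 2 :=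
    Real.sq_sqrt (Finset.sum_nonneg fun i _ => sq_nonneg _)
  simp only [hsq, Fintype.card_fin, Nat.add_sub_cancel] at hradial
  have htrunc : (∫ r in Set.Ioi (0 : ℝ), r ^ n * (Real.exp (-r ^ 2 / 2) *
      if r ≤ 1 / α then 2 * α ^ 2 * r ^ 2 - 2 * α * r else 0)) =
      ∫ r in (0 : ℝ)..1 / α, (2 * α ^ 2 * (r ^ (n + 1 + 1) * Real.exp (-r ^ 2 / 2)) -
        2 * α * (r ^ (n + 1) * Real.exp (-r ^ 2 / 2))) := by
    rw [intervalIntegral.integral_of_le (by positivity), ← Set.Ioi_inter_Iic,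
      ← setIntegral_indicator measurableSet_Iic]
    refine setIntegral_congr_fun measurableSet_Ioi fun r _ => ?_
    by_cases hr : r ≤ 1 / α
    · simp only [if_pos hr, Set.indicator_of_mem (Set.mem_Iic.2 hr)]
      ring
    · simp only [if_neg hr, Set.indicator_of_notMem (mt Set.mem_Iic.1 hr), mul_zero]
  rw [hradial, htrunc, intervalIntegral.integral_sub
    (Continuous.intervalIntegrable (by fun_prop) _ _)
    (Continuous.intervalIntegrable (by fun_prop) _ _), intervalIntegral.integral_const_mul,
    intervalIntegral.integral_const_mul,
    integral_pow_mul_exp_neg_sq_div_two _ (by positivity),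
    integral_pow_mul_exp_neg_sq_div_two _ (by positivity)]
  have hb : (1 / α) ^ 2 / 2 = 1 / (2 * α ^ 2) := by field_simp
  have hn : ((n + 1 : ℕ) : ℝ) + 1 = n + 2 := by push_cast; ring
  rw [hb, hn]
  field_simp
  rw [pow_succ]
  ring_nf
  rw [Real.sq_sqrt zero_le_two]
  ring
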